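/- Fix σ_ε ≥ 0, σ_0 ≥ 0, ρ_1 ∈ [0,1], ρ_2 ∈ [0,1), q_1, q_2 ∈ ℝ, Φ_0 = σ_ε²(1−ρ_1) + σ_0²(1−ρ_2) > 0 and z > 0. Set m(τ) = σ_ε q_1 + q_2√(σ_0² + τ²), v(τ) = σ_ε²(1−ρ_1) + (σ_0² + τ²)(1−ρ_2), μ_0 = σ_ε q_1 + σ_0 q_2, and define T_NP(τ) = Φ((μ_0 + z√Φ_0 − m(τ))/√v(τ)) − Φ((μ_0 − z√Φ_0 − m(τ))/√v(τ)). Then lim_{τ→∞} τ·T_NP(τ) = (2z√Φ_0/√(1−ρ_2))·φ(q_2/√(1−ρ_2)). -/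

import Mathlib

open MeasureTheory ProbabilityTheory Filter

/-- The standard normal cumulative distribution function `Φ`. -/
noncomputable def stdGaussCDF (x : ℝ) : ℝ :=
  ((gaussianReal 0 1) (Set.Iic x)).toReal

/-- The standard normal density `φ(x) = (2π)^{-1/2} e^{-x²/2}`. -/
noncomputable def stdGaussPDF (x : ℝ) : ℝ :=
  (Real.sqrt (2 * Real.pi))⁻¹ * Real.exp (-x ^ 2 / 2)

theorem continuous_stdGaussPDF : Continuous stdGaussPDF := by
  unfold stdGaussPDF
  fun_prop

theorem stdGaussPDF_eq_gaussianPDFReal : stdGaussPDF = gaussianPDFReal 0 1 := by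
  ext x
  simp [stdGaussPDF, gaussianPDFReal]

theorem integrable_stdGaussPDF : Integrable stdGaussPDF := by
  rw [stdGaussPDF_eq_gaussianPDFReal]
  exact integrable_gaussianPDFReal 0 1

theorem stdGaussPDF_neg (x : ℝ) : stdGaussPDF (-x) = stdGaussPDF x := by
  simp [stdGaussPDF]

theorem stdGaussCDF_eq_integral (x : ℝ) :
    stdGaussCDF x = ∫ t in Set.Iic x, stdGaussPDF t := by
  rw [stdGaussCDF, gaussianReal_apply_eq_integral 0 one_ne_zero, ENNReal.toReal_ofReal,
    stdGaussPDF_eq_gaussianPDFReal]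
  exact integral_nonneg fun t => gaussianPDFReal_nonneg 0 1 t

theorem hasStrictDerivAt_stdGaussCDF (x : ℝ) :
    HasStrictDerivAt stdGaussCDF (stdGaussPDF x) x := by
  have hsplit : stdGaussCDF = fun y => stdGaussCDF 0 + ∫ t in (0 : ℝ)..y, stdGaussPDF t := by
    ext y
    rw [stdGaussCDF_eq_integral, stdGaussCDF_eq_integral,
      ← intervalIntegral.integral_Iic_sub_Iic integrable_stdGaussPDF.integrableOn
        integrable_stdGaussPDF.integrableOn]
    ring
  rw [hsplit]
  exact (intervalIntegral.integral_hasStrictDerivAt_right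
    (continuous_stdGaussPDF.intervalIntegrable _ _)
    (continuous_stdGaussPDF.stronglyMeasurableAtFilter _ _)
    continuous_stdGaussPDF.continuousAt).const_add _

/-- Rescaled increments of a strictly differentiable function converge to the rescaled increment
of the argument times the derivative. -/
theorem HasStrictDerivAt.tendsto_mul_sub {ι : Type*} {l : Filter ι} {f : ℝ → ℝ} {f' x c : ℝ}
    (hf : HasStrictDerivAt f f' x) {a b g : ι → ℝ} (ha : Tendsto a l (nhds x))
    (hb : Tendsto b l (nhds x)) (hg : Tendsto (fun i => g i * (a i - b i)) l (nhds c)) :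
    Tendsto (fun i => g i * (f (a i) - f (b i))) l (nhds (c * f')) := by
  have hab : Tendsto (fun i => (a i, b i)) l (nhds (x, x)) := ha.prodMk_nhds hb
  have ho := hf.hasStrictFDerivAt.isLittleO.comp_tendsto hab
  have hrem := ((Asymptotics.isBigO_refl g l).mul_isLittleO ho).trans_isBigO (hg.isBigO_one ℝ)
  have hsum := ((Asymptotics.isLittleO_one_iff ℝ).1 hrem).add (hg.mul_const f')
  rw [zero_add] at hsum
  refine hsum.congr fun i => ?_
  simp only [Function.comp_apply, ContinuousLinearMap.toSpanSingleton_apply, smul_eq_mul]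
  ring

theorem tendsto_sqrt_add_mul_sq_div_atTop (A B : ℝ) :
    Tendsto (fun τ : ℝ => Real.sqrt (A + B * τ ^ 2) / τ) atTop (nhds (Real.sqrt B)) := by
  have h₁ : Tendsto (fun τ : ℝ => A / τ ^ 2 + B) atTop (nhds (0 + B)) :=
    (tendsto_const_nhds.div_atTop (tendsto_pow_atTop two_ne_zero)).add tendsto_const_nhds
  rw [zero_add] at h₁
  refine h₁.sqrt.congr' ?_
  filter_upwards [eventually_gt_atTop 0] with τ hτ
  rw [← Real.sqrt_sq hτ.le, ← Real.sqrt_div' _ (sq_nonneg _), Real.sqrt_sq hτ.le]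
  congr 1
  field_simp

/-- Equation (14): leading-order term of the type II error of the asymptotic
Neyman–Pearson test. With `m(τ) = σ_ε q₁ + q₂√(σ₀²+τ²)`,
`v(τ) = σ_ε²(1-ρ₁) + (σ₀²+τ²)(1-ρ₂)`, `μ₀ = σ_ε q₁ + σ₀ q₂`,
`Φ₀ = σ_ε²(1-ρ₁) + σ₀²(1-ρ₂) > 0`, and
`T_NP(τ) = Φ((μ₀+z√Φ₀-m(τ))/√v(τ)) - Φ((μ₀-z√Φ₀-m(τ))/√v(τ))`,
one has `τ·T_NP(τ) → (2z√Φ₀/√(1-ρ₂))·φ(q₂/√(1-ρ₂))` as `τ → ∞`. -/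
theorem typeII_NP_leading_term (σε σ₀ ρ₁ ρ₂ : ℝ) (hσε : 0 ≤ σε) (hσ₀ : 0 ≤ σ₀)
    (hρ₁ : ρ₁ ∈ Set.Icc (0 : ℝ) 1) (hρ₂ : ρ₂ ∈ Set.Ico (0 : ℝ) 1)
    (q₁ q₂ : ℝ) (Φ₀ : ℝ) (hΦ₀def : Φ₀ = σε ^ 2 * (1 - ρ₁) + σ₀ ^ 2 * (1 - ρ₂))
    (hΦ₀ : 0 < Φ₀) (z : ℝ) (hz : 0 < z)
    (m v : ℝ → ℝ) (μ₀ : ℝ) (TNP : ℝ → ℝ)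
    (hm : ∀ τ, m τ = σε * q₁ + q₂ * Real.sqrt (σ₀ ^ 2 + τ ^ 2))
    (hv : ∀ τ, v τ = σε ^ 2 * (1 - ρ₁) + (σ₀ ^ 2 + τ ^ 2) * (1 - ρ₂))
    (hμ₀ : μ₀ = σε * q₁ + σ₀ * q₂)
    (hTNP : ∀ τ, TNP τ =
      stdGaussCDF ((μ₀ + z * Real.sqrt Φ₀ - m τ) / Real.sqrt (v τ)) -
        stdGaussCDF ((μ₀ - z * Real.sqrt Φ₀ - m τ) / Real.sqrt (v τ))) :
    Tendsto (fun τ => τ * TNP τ) atTop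
      (nhds ((2 * z * Real.sqrt Φ₀ / Real.sqrt (1 - ρ₂)) *
        stdGaussPDF (q₂ / Real.sqrt (1 - ρ₂)))) := by
  have hpos : 0 < 1 - ρ₂ := sub_pos.2 hρ₂.2
  have hs : Real.sqrt (1 - ρ₂) ≠ 0 := (Real.sqrt_pos.2 hpos).ne'
  have hsd : Tendsto (fun τ => Real.sqrt (v τ) / τ) atTop (nhds (Real.sqrt (1 - ρ₂))) := by
    refine (tendsto_sqrt_add_mul_sq_div_atTop
      (σε ^ 2 * (1 - ρ₁) + σ₀ ^ 2 * (1 - ρ₂)) (1 - ρ₂)).congr fun τ => ?_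
    rw [hv]
    ring_nf
  have hm_div : Tendsto (fun τ => m τ / τ) atTop (nhds q₂) := by
    have h := ((tendsto_const_nhds (x := σε * q₁)).div_atTop tendsto_id).add
      ((tendsto_sqrt_add_mul_sq_div_atTop (σ₀ ^ 2) 1).const_mul q₂)
    simp only [Real.sqrt_one, mul_one, zero_add, one_mul] at h
    refine h.congr fun τ => ?_
    rw [hm, id]
    ring
  have hend (C : ℝ) : Tendsto (fun τ => (C - m τ) / Real.sqrt (v τ)) atTop
      (nhds (-(q₂ / Real.sqrt (1 - ρ₂)))) := by
    have h := (((tendsto_const_nhds (x := C)).div_atTop tendsto_id).sub hm_div).div hsd hs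
    rw [zero_sub, neg_div] at h
    refine h.congr' ?_
    filter_upwards [eventually_gt_atTop 0] with τ hτ
    simp only [Pi.div_apply, id, ← sub_div]
    exact div_div_div_cancel_right₀ hτ.ne' _ _
  have hwidth : Tendsto (fun τ => τ * ((μ₀ + z * Real.sqrt Φ₀ - m τ) / Real.sqrt (v τ) -
      (μ₀ - z * Real.sqrt Φ₀ - m τ) / Real.sqrt (v τ))) atTop
      (nhds (2 * z * Real.sqrt Φ₀ / Real.sqrt (1 - ρ₂))) := by
    refine ((tendsto_const_nhds (x := 2 * z * Real.sqrt Φ₀)).div hsd hs).congr fun τ => ?_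
    rw [Pi.div_apply, div_div_eq_mul_div, ← sub_div]
    ring
  simp only [hTNP]
  rw [← stdGaussPDF_neg]
  exact (hasStrictDerivAt_stdGaussCDF _).tendsto_mul_sub (hend _) (hend _) hwidth
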